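/- Let X ⊆ ℂ^n be a Zariski-closed set that is irreducible (in the complex Zariski topology) and observable over the reals, i.e., the Krull dimension of X_ℝ := X ∩ ℝ^n (real Zariski topology) equals the Krull dimension of X (complex Zariski topology). Let Z ⊆ X be Zariski-closed with Z ≠ X. Then the Krull dimension of Z ∩ ℝ^n in the real Zariski topology is strictly smaller than the Krull dimension of X_ℝ. Consequently, if a property fails only on such a proper Zariski-closed subset Z of X (i.e., a generic point of X has the property), then a generic point of X_ℝ has the property as well. -/

import Mathlib

/-- The Zariski topology on `σ → K`: the topology generated by the basic open
sets `{x | p(x) ≠ 0}` for polynomials `p`; its closed sets are exactly the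
common zero sets of families of polynomials over `K`. -/
def zariskiTopology (σ K : Type*) [CommSemiring K] : TopologicalSpace (σ → K) :=
  TopologicalSpace.generateFrom
    {U | ∃ p : MvPolynomial σ K, U = {x | MvPolynomial.eval x p ≠ 0}}

open TopologicalSpace Topology

/-- A non-dense inducing map into an irreducible space of finite dimension drops the dimension. -/
lemma aux_dim_lt {A B : Type*} [TopologicalSpace A] [TopologicalSpace B] [IrreducibleSpace B]
    (f : A → B) (hf : IsInducing f) (C : Set B) (hC : IsClosed C) (hfC : ∀ a, f a ∈ C)
    (hne : C ≠ Set.univ) (m : ℕ) (hfin : topologicalKrullDim B ≤ m) :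
    topologicalKrullDim A < topologicalKrullDim B := by
  let tp : IrreducibleCloseds B :=
    ⟨Set.univ, IrreducibleSpace.isIrreducible_univ B, isClosed_univ⟩
  rcases isEmpty_or_nonempty (IrreducibleCloseds A) with hA | hA
  · have h1 : topologicalKrullDim A = ⊥ := Order.krullDim_eq_bot
    haveI : Nonempty (IrreducibleCloseds B) := ⟨tp⟩
    rw [h1]
    exact lt_of_lt_of_le (WithBot.bot_lt_coe _) (Order.krullDim_nonneg (α := IrreducibleCloseds B))
  · let g : WithTop (IrreducibleCloseds A) → IrreducibleCloseds B := fun x =>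
      WithTop.recTopCoe tp (fun a => IrreducibleCloseds.map f hf.continuous a) x
    have hlt : ∀ a, IrreducibleCloseds.map f hf.continuous a < tp := by
      intro a
      refine lt_of_le_of_ne (fun x _ => Set.mem_univ x) ?_
      intro h
      apply hne
      have h2 : closure (f '' (a : Set A)) = Set.univ := congrArg (fun s : IrreducibleCloseds B => (s : Set B)) h
      apply Set.eq_univ_of_univ_subset
      rw [← h2]
      apply closure_minimal _ hC
      rintro _ ⟨x, -, rfl⟩
      exact hfC x
    have hg : StrictMono g := by
      intro x y hxy
      induction x with
      | top => exact absurd hxy (not_top_lt)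
      | coe x =>
        induction y with
        | top => exact hlt x
        | coe y =>
          exact IrreducibleCloseds.map_strictMono_of_isInducing hf (WithTop.coe_lt_coe.1 hxy)
    have h3 := Order.krullDim_le_of_strictMono g hg
    rw [Order.krullDim_WithTop] at h3
    change topologicalKrullDim A + 1 ≤ topologicalKrullDim B at h3
    haveI : Nonempty (IrreducibleCloseds B) := ⟨tp⟩
    have h5 : 0 ≤ topologicalKrullDim B := Order.krullDim_nonneg (α := IrreducibleCloseds B)
    have h6 : ∃ k : ℕ, topologicalKrullDim B = k := by
      generalize topologicalKrullDim B = v at hfin h5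
      induction v with
      | bot => simp at h5
      | coe v =>
        induction v with
        | top => exact absurd (WithBot.coe_le_coe.1 hfin) (by simp)
        | coe v => exact ⟨v, rfl⟩
    obtain ⟨k, hk⟩ := h6
    rw [hk] at h3 ⊢
    exact ENat.WithBot.add_one_le_natCast_iff.1 h3

lemma aux_isInducing_point (n : ℕ) :
    @IsInducing _ _ (zariskiTopology (Fin n) ℂ) _
      (MvPolynomial.pointToPoint (k := ℂ) : (Fin n → ℂ) → PrimeSpectrum (MvPolynomial (Fin n) ℂ)) := by
  letI := zariskiTopology (Fin n) ℂ
  constructor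
  rw [PrimeSpectrum.isTopologicalBasis_basic_opens.eq_generateFrom, induced_generateFrom_eq]
  change TopologicalSpace.generateFrom _ = _
  congr 1
  have key : ∀ p : MvPolynomial (Fin n) ℂ, MvPolynomial.pointToPoint (k := ℂ) ⁻¹'
      (PrimeSpectrum.basicOpen p : Set (PrimeSpectrum (MvPolynomial (Fin n) ℂ)))
      = {x : Fin n → ℂ | MvPolynomial.eval x p ≠ 0} := by
    intro p
    ext x
    simp [MvPolynomial.pointToPoint, MvPolynomial.mem_vanishingIdeal_iff, MvPolynomial.aeval_eq_eval]
  ext U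
  constructor
  · rintro ⟨p, rfl⟩
    exact ⟨_, ⟨p, rfl⟩, key p⟩
  · rintro ⟨_, ⟨p, rfl⟩, rfl⟩
    exact ⟨p, key p⟩

lemma aux_dim_le (n : ℕ) :
    @topologicalKrullDim (Fin n → ℂ) (zariskiTopology (Fin n) ℂ) ≤ (n : ℕ) := by
  letI := zariskiTopology (Fin n) ℂ
  refine (aux_isInducing_point n).topologicalKrullDim_le.trans ?_
  rw [PrimeSpectrum.topologicalKrullDim_eq_ringKrullDim,
    MvPolynomial.ringKrullDim_of_isNoetherianRing]
  simp

lemma aux_decomp (n : ℕ) (p : MvPolynomial (Fin n) ℂ) :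
    ∃ a b : MvPolynomial (Fin n) ℝ, ∀ x : Fin n → ℝ,
      MvPolynomial.eval (fun i => (x i : ℂ)) p
        = (MvPolynomial.eval x a : ℂ) + (MvPolynomial.eval x b : ℂ) * Complex.I := by
  induction p using MvPolynomial.induction_on with
  | C z =>
    refine ⟨MvPolynomial.C z.re, MvPolynomial.C z.im, fun x => ?_⟩
    simp [Complex.re_add_im]
  | add p q hp hq =>
    obtain ⟨a, b, h⟩ := hp
    obtain ⟨c, d, h'⟩ := hq
    refine ⟨a + c, b + d, fun x => ?_⟩
    simp only [map_add, h, h', Complex.ofReal_add]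
    ring
  | mul_X p i hp =>
    obtain ⟨a, b, h⟩ := hp
    refine ⟨a * MvPolynomial.X i, b * MvPolynomial.X i, fun x => ?_⟩
    simp only [map_mul, h, MvPolynomial.eval_X, Complex.ofReal_mul]
    ring

lemma aux_isInducing_real (n : ℕ) :
    @IsInducing _ _ (zariskiTopology (Fin n) ℝ) (zariskiTopology (Fin n) ℂ)
      (fun x : Fin n → ℝ => fun i => (x i : ℂ)) := by
  letI := zariskiTopology (Fin n) ℝ
  letI := zariskiTopology (Fin n) ℂ
  constructor
  change _ = TopologicalSpace.induced _ (TopologicalSpace.generateFrom _)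
  rw [induced_generateFrom_eq]
  apply le_antisymm
  · apply le_generateFrom
    rintro _ ⟨_, ⟨p, rfl⟩, rfl⟩
    obtain ⟨a, b, h⟩ := aux_decomp n p
    have h1 : IsOpen {x : Fin n → ℝ | MvPolynomial.eval x a ≠ 0} :=
      TopologicalSpace.isOpen_generateFrom_of_mem ⟨a, rfl⟩
    have h2 : IsOpen {x : Fin n → ℝ | MvPolynomial.eval x b ≠ 0} :=
      TopologicalSpace.isOpen_generateFrom_of_mem ⟨b, rfl⟩
    convert h1.union h2 using 1
    ext x
    simp only [Set.mem_preimage, Set.mem_ofPred_eq, Set.mem_union, h, ne_eq, Complex.ext_iff]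
    simp
    tauto
  · apply le_generateFrom
    rintro _ ⟨p, rfl⟩
    apply TopologicalSpace.isOpen_generateFrom_of_mem
    refine ⟨_, ⟨MvPolynomial.map Complex.ofRealHom p, rfl⟩, ?_⟩
    ext x
    have : MvPolynomial.eval (fun i => (x i : ℂ)) (MvPolynomial.map Complex.ofRealHom p)
        = ((MvPolynomial.eval x p : ℝ) : ℂ) := by
      rw [MvPolynomial.eval_map]
      exact (MvPolynomial.eval₂_comp_left Complex.ofRealHom (RingHom.id ℝ) x p).symm
    change MvPolynomial.eval (fun i => (x i : ℂ)) (MvPolynomial.map Complex.ofRealHom p) ≠ 0 ↔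
      MvPolynomial.eval x p ≠ 0
    rw [this, ne_eq, Complex.ofReal_eq_zero]

lemma aux_closed (n : ℕ) (T : Set (MvPolynomial (Fin n) ℂ)) :
    @IsClosed _ (zariskiTopology (Fin n) ℂ) {x | ∀ p ∈ T, MvPolynomial.eval x p = 0} := by
  letI := zariskiTopology (Fin n) ℂ
  have : {x : Fin n → ℂ | ∀ p ∈ T, MvPolynomial.eval x p = 0}
      = ⋂ p ∈ T, {x | MvPolynomial.eval x p ≠ 0}ᶜ := by
    ext x; simp
  rw [this]
  refine isClosed_biInter fun p _ => IsOpen.isClosed_compl ?_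
  exact TopologicalSpace.isOpen_generateFrom_of_mem ⟨p, rfl⟩

/-- Any set of real points lying in `Z` has smaller dimension than `X`. -/
lemma aux_main (n : ℕ) (X Z : Set (Fin n → ℂ))
    (hirr : @IsIrreducible _ (zariskiTopology (Fin n) ℂ) X)
    (hZ : ∃ T : Set (MvPolynomial (Fin n) ℂ),
      Z = {x | ∀ p ∈ T, MvPolynomial.eval x p = 0})
    (hZX : Z ⊆ X) (hne : Z ≠ X) (Q : (Fin n → ℝ) → Prop)
    (hQ : ∀ x, Q x → (fun i => (x i : ℂ)) ∈ Z) :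
    @topologicalKrullDim {x : Fin n → ℝ // Q x}
        (TopologicalSpace.induced Subtype.val (zariskiTopology (Fin n) ℝ))
      < @topologicalKrullDim X
        (TopologicalSpace.induced Subtype.val (zariskiTopology (Fin n) ℂ)) := by
  letI := zariskiTopology (Fin n) ℝ
  letI := zariskiTopology (Fin n) ℂ
  haveI : IrreducibleSpace X := Subtype.irreducibleSpace hirr
  obtain ⟨T, hT⟩ := hZ
  have hZc : IsClosed Z := hT ▸ aux_closed n T
  let f : {x : Fin n → ℝ // Q x} → X := fun x => ⟨fun i => (x.1 i : ℂ), hZX (hQ x.1 x.2)⟩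
  have hf : IsInducing f := by
    have h := (aux_isInducing_real n).comp (IsInducing.subtypeVal (t := {x | Q x}))
    exact (IsInducing.of_comp_iff (IsInducing.subtypeVal (t := X))).1 h
  refine aux_dim_lt f hf (Subtype.val ⁻¹' Z) (hZc.preimage continuous_subtype_val)
    (fun a => hQ a.1 a.2) ?_ n ((topologicalKrullDim_subspace_le _ X).trans (aux_dim_le n))
  intro h
  apply hne
  refine hZX.antisymm fun x hx => ?_
  have : (⟨x, hx⟩ : X) ∈ (Subtype.val ⁻¹' Z : Set X) := h ▸ Set.mem_univ _
  exact this

/-- Let `X ⊆ ℂ^n` be Zariski-closed, irreducible and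
observable over the reals, and let `Z ⊆ X` be Zariski-closed with `Z ≠ X`. Then
the Krull dimension of `Z ∩ ℝ^n` (real Zariski topology) is strictly smaller
than that of `X_ℝ = X ∩ ℝ^n`. Consequently, for every property `P` failing on
`X` only inside `Z`, the set of real points of `X` where `P` fails has strictly
smaller dimension than `X_ℝ` — i.e. a generic point of `X_ℝ` has `P`. -/
theorem stmt_11 (n : ℕ) (X Z : Set (Fin n → ℂ))
    (hX : ∃ T : Set (MvPolynomial (Fin n) ℂ),
      X = {x | ∀ p ∈ T, MvPolynomial.eval x p = 0})
    (hirr : @IsIrreducible _ (zariskiTopology (Fin n) ℂ) X)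
    (hobs : @topologicalKrullDim {x : Fin n → ℝ // (fun i => (x i : ℂ)) ∈ X}
        (TopologicalSpace.induced Subtype.val (zariskiTopology (Fin n) ℝ))
      = @topologicalKrullDim X
        (TopologicalSpace.induced Subtype.val (zariskiTopology (Fin n) ℂ)))
    (hZ : ∃ T : Set (MvPolynomial (Fin n) ℂ),
      Z = {x | ∀ p ∈ T, MvPolynomial.eval x p = 0})
    (hZX : Z ⊆ X) (hne : Z ≠ X) :
    @topologicalKrullDim {x : Fin n → ℝ // (fun i => (x i : ℂ)) ∈ Z}
        (TopologicalSpace.induced Subtype.val (zariskiTopology (Fin n) ℝ))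
      < @topologicalKrullDim {x : Fin n → ℝ // (fun i => (x i : ℂ)) ∈ X}
        (TopologicalSpace.induced Subtype.val (zariskiTopology (Fin n) ℝ)) ∧
    ∀ P : (Fin n → ℝ) → Prop,
      {x : Fin n → ℝ | (fun i => (x i : ℂ)) ∈ X ∧ ¬ P x}
        ⊆ {x : Fin n → ℝ | (fun i => (x i : ℂ)) ∈ Z} →
      @topologicalKrullDim {x : Fin n → ℝ // (fun i => (x i : ℂ)) ∈ X ∧ ¬ P x}
          (TopologicalSpace.induced Subtype.val (zariskiTopology (Fin n) ℝ))
        < @topologicalKrullDim {x : Fin n → ℝ // (fun i => (x i : ℂ)) ∈ X}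
          (TopologicalSpace.induced Subtype.val (zariskiTopology (Fin n) ℝ)) := by
  rw [hobs]
  refine ⟨aux_main n X Z hirr hZ hZX hne _ (fun x hx => hx), fun P hP => ?_⟩
  exact aux_main n X Z hirr hZ hZX hne _ (fun x hx => hP hx)
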